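/- Let G be a position with c(G) < 2 that has no 4-loops but has at least one 3-chain. Then opening a 3-chain is optimal, and v(G) = 2 if size(G) is even; v(G) = 3 if θ(G) = 1 and size(G) ≡ 3 (mod 4); and v(G) = 1 otherwise. -/

import Mathlib

namespace DotsAndBoxes

/-- A component of a Dots & Boxes endgame position: an `n`-chain or an `n`-loop. -/
inductive Component : Type where
  | chain (n : ℕ)
  | loop (n : ℕ)
deriving DecidableEq

namespace Component

/-- The number of boxes in a component. -/
def size : Component → ℕ
  | chain n => n
  | loop n => n

def isChain : Component → Bool
  | chain _ => true
  | loop _ => false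

def isLoop : Component → Bool
  | chain _ => false
  | loop _ => true

/-- A chain must have length at least 3; a loop must have even length at least 4. -/
def Valid : Component → Prop
  | chain n => 3 ≤ n
  | loop n => 4 ≤ n ∧ Even n

end Component

/-- A position is a finite multiset of components. -/
abbrev Position := Multiset Component

def Position.Valid (G : Position) : Prop := ∀ C ∈ G, C.Valid

/-- The number of unclaimed boxes in a position. -/
def size (G : Position) : ℕ := (G.map Component.size).sum

/-- The number of chains of a position. -/
def numChains (G : Position) : ℕ := Multiset.card (G.filter fun C => C.isChain = true)

/-- The number of loops of a position. -/
def numLoops (G : Position) : ℕ := Multiset.card (G.filter fun C => C.isLoop = true)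

/-- θ(G), the number of 3-chains. -/
def theta (G : Position) : ℕ := G.count (Component.chain 3)

/-- f(G), the number of 4-loops. -/
def numF (G : Position) : ℕ := G.count (Component.loop 4)

/-- s(G), the number of 6-loops. -/
def numS (G : Position) : ℕ := G.count (Component.loop 6)

open Classical in
/-- The terminal bonus tb(G). -/
noncomputable def tb (G : Position) : ℤ :=
  if G = 0 then 0
  else if ∀ C ∈ G, C.isLoop = true then 8
  else if (∃ C ∈ G, C.isLoop = true) ∧ Component.chain 3 ∈ G ∧
      (∀ C ∈ G, C.isChain = true → C = Component.chain 3) then 6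
  else 4

/-- The controlled value c(G). -/
noncomputable def cval (G : Position) : ℤ :=
  (size G : ℤ) - 4 * (numChains G : ℤ) - 8 * (numLoops G : ℤ) + tb G

/-- The score v(G;C) of opening component `C`, given that the remainder of the
position has value `w`. -/
def openVal (C : Component) (w : ℤ) : ℤ :=
  match C with
  | Component.chain n => ((n : ℤ) - 2) + |w - 2|
  | Component.loop n => ((n : ℤ) - 4) + |w - 4|

/-- Auxiliary recursion (on the number of components) for the value `v`. -/
noncomputable def valueAux : ℕ → Position → ℤ
  | 0, _ => 0
  | n + 1, G =>
    if G = 0 then 0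
    else sInf { x : ℤ | ∃ C ∈ G, x = openVal C (valueAux n (G.erase C)) }

/-- The value v(G): v(∅) = 0, and v(G) = min over components C of G of v(G;C). -/
noncomputable def value (G : Position) : ℤ := valueAux (Multiset.card G) G

/-- v(G;C), the value of G given that the opener has just opened C. -/
noncomputable def valueOpen (G : Position) (C : Component) : ℤ :=
  openVal C (value (G.erase C))

/-- Opening a component C of G is optimal if C ∈ G and v(G;C) = v(G). -/
def Optimal (G : Position) (C : Component) : Prop :=
  C ∈ G ∧ valueOpen G C = value G


/-- weight of a component: its contribution to the controlled value -/
def wt : Component → ℤ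
  | Component.chain n => (n : ℤ) - 4
  | Component.loop n => (n : ℤ) - 8

def W (G : Position) : ℤ := (G.map wt).sum

@[simp] lemma W_zero : W 0 = 0 := by simp [W]
@[simp] lemma W_cons (C : Component) (G : Position) : W (C ::ₘ G) = wt C + W G := by simp [W]
@[simp] lemma W_single (C : Component) : W {C} = wt C := by simp [W]
@[simp] lemma size_zero' : size 0 = 0 := by simp [size]
@[simp] lemma size_cons' (C : Component) (G : Position) :
    size (C ::ₘ G) = C.size + size G := by simp [size]

lemma cval_eq (G : Position) : cval G = W G + tb G := by
  have h : (size G : ℤ) - 4 * (numChains G : ℤ) - 8 * (numLoops G : ℤ) = W G := by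
    induction G using Multiset.induction with
    | empty => simp [numChains, numLoops]
    | cons C G ih =>
      cases C with
      | chain n =>
        have h1 : numChains (Component.chain n ::ₘ G) = numChains G + 1 := by
          rw [numChains, Multiset.filter_cons_of_pos _ (by simp [Component.isChain, Component.isLoop]), Multiset.card_cons, numChains]
        have h2 : numLoops (Component.chain n ::ₘ G) = numLoops G := by
          rw [numLoops, Multiset.filter_cons_of_neg _ (by simp [Component.isLoop]), numLoops]
        rw [h1, h2, size_cons', W_cons, ← ih]
        simp only [wt, Component.size]; push_cast; ring
      | loop n =>
        have h1 : numLoops (Component.loop n ::ₘ G) = numLoops G + 1 := by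
          rw [numLoops, Multiset.filter_cons_of_pos _ (by simp [Component.isChain, Component.isLoop]), Multiset.card_cons, numLoops]
        have h2 : numChains (Component.loop n ::ₘ G) = numChains G := by
          rw [numChains, Multiset.filter_cons_of_neg _ (by simp [Component.isChain]), numChains]
        rw [h1, h2, size_cons', W_cons, ← ih]
        simp only [wt, Component.size]; push_cast; ring
  rw [cval, h]

lemma value_zero : value 0 = 0 := by simp [value, valueAux]

lemma value_set (G : Position) (h : G ≠ 0) :
    value G = sInf { x : ℤ | ∃ C ∈ G, x = openVal C (value (G.erase C)) } := by
  obtain ⟨n, hn⟩ : ∃ n, Multiset.card G = n + 1 :=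
    Nat.exists_eq_succ_of_ne_zero (by simpa using h)
  have : value G = valueAux (n + 1) G := by rw [value, hn]
  rw [this, valueAux, if_neg h]
  congr 1
  ext x
  simp only [Set.mem_ofPred_eq]
  refine exists_congr fun C => and_congr_right fun hC => ?_
  rw [value, Multiset.card_erase_of_mem hC, hn]
  rfl

lemma set_bdd (G : Position) :
    BddBelow { x : ℤ | ∃ C ∈ G, x = openVal C (value (G.erase C)) } := by
  apply Set.Finite.bddBelow
  have := (G.toFinset.finite_toSet).image (fun C => openVal C (value (G.erase C)))
  refine this.subset ?_
  rintro x ⟨C, hC, rfl⟩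
  exact ⟨C, by simpa using hC, rfl⟩

lemma value_le (C : Component) (G : Position) : value (C ::ₘ G) ≤ openVal C (value G) := by
  rw [value_set _ (Multiset.cons_ne_zero)]
  refine csInf_le (set_bdd _) ⟨C, by simp, by simp⟩

lemma value_ex (G : Position) (h : G ≠ 0) :
    ∃ C H, G = C ::ₘ H ∧ value G = openVal C (value H) := by
  have hne : { x : ℤ | ∃ C ∈ G, x = openVal C (value (G.erase C)) }.Nonempty := by
    obtain ⟨C, hC⟩ := Multiset.exists_mem_of_ne_zero h
    exact ⟨_, C, hC, rfl⟩
  obtain ⟨C, hC, e⟩ := Int.csInf_mem hne (set_bdd G)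
  exact ⟨C, G.erase C, (Multiset.cons_erase hC).symm, by rw [value_set G h, e]⟩

lemma value_parity (G : Position) : (value G - size G) % 2 = 0 := by
  induction G using Multiset.strongInductionOn with
  | ih G ih =>
    by_cases h : G = 0
    · subst h; simp [value_zero]
    obtain ⟨C, H, rfl, e⟩ := value_ex G h
    have := ih H (Multiset.lt_cons_self _ _)
    rw [e]
    cases C with
    | chain n =>
      simp only [openVal, size_cons', Component.size]; push_cast
      rcases abs_cases (value H - 2) with h | h <;> omega
    | loop n =>
      simp only [openVal, size_cons', Component.size]; push_cast
      rcases abs_cases (value H - 4) with h | h <;> omega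

/-- components allowed: chains of length at least `k`, even loops of length at least 6 -/
def Ok (k : ℕ) : Component → Prop
  | Component.chain n => k ≤ n
  | Component.loop n => 6 ≤ n ∧ n % 2 = 0

lemma value_pos (G : Position) (h : G ≠ 0) (hG : ∀ C ∈ G, Ok 3 C) : 1 ≤ value G := by
  obtain ⟨C, H, rfl, e⟩ := value_ex G h
  have hC := hG C (by simp)
  rw [e]
  cases C with
  | chain n =>
    simp only [openVal, Ok] at *
    have := abs_nonneg (value H - 2); omega
  | loop n =>
    simp only [openVal, Ok] at *
    have := abs_nonneg (value H - 4); omega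

lemma value_two (G : Position) (h : G ≠ 0) (hG : ∀ C ∈ G, Ok 4 C) : 2 ≤ value G := by
  obtain ⟨C, H, rfl, e⟩ := value_ex G h
  have hC := hG C (by simp)
  rw [e]
  cases C with
  | chain n =>
    simp only [openVal, Ok] at *
    have := abs_nonneg (value H - 2); omega
  | loop n =>
    simp only [openVal, Ok] at *
    have := abs_nonneg (value H - 4); omega

def HC (G : Position) : Prop := ∃ C ∈ G, C.isChain = true

open Classical in
/-- terminal bonus for nonempty positions without 3-chains -/
noncomputable def t (G : Position) : ℤ := if HC G then 4 else 8

lemma t_cases (G : Position) : t G = 4 ∨ t G = 8 := by unfold t; split_ifs <;> simp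
@[simp] lemma t_loop (n : ℕ) (G : Position) : t (Component.loop n ::ₘ G) = t G := by
  have : HC (Component.loop n ::ₘ G) ↔ HC G := by
    constructor
    · rintro ⟨C, hC, h⟩
      rcases Multiset.mem_cons.1 hC with rfl | hC
      · simp [Component.isChain] at h
      · exact ⟨C, hC, h⟩
    · rintro ⟨C, hC, h⟩
      exact ⟨C, Multiset.mem_cons_of_mem hC, h⟩
  by_cases h : HC G
  · rw [t, t, if_pos h, if_pos (this.2 h)]
  · rw [t, t, if_neg h, if_neg (fun h' => h (this.1 h'))]
@[simp] lemma t_chain (n : ℕ) (G : Position) : t (Component.chain n ::ₘ G) = 4 := by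
  rw [t, if_pos ⟨_, Multiset.mem_cons_self _ _, rfl⟩]
@[simp] lemma t_zero : t 0 = 8 := by simp [t, HC]
@[simp] lemma t_sloop (n : ℕ) : t {Component.loop n} = 8 := (t_loop n 0).trans t_zero
@[simp] lemma t_schain (n : ℕ) : t {Component.chain n} = 4 := t_chain n 0

lemma lower (G : Position) (h : G ≠ 0) (hG : ∀ C ∈ G, Ok 4 C) : W G + t G ≤ value G := by
  induction G using Multiset.strongInductionOn with
  | ih G ih =>
    obtain ⟨C, H, rfl, e⟩ := value_ex G h
    have hC := hG C (by simp)
    have hH : ∀ C ∈ H, Ok 4 C := fun C hC => hG C (by simp [hC])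
    rw [e]
    by_cases h0 : H = 0
    · subst h0
      cases C <;> simp [openVal, wt, value_zero]
    have := ih H (Multiset.lt_cons_self _ _) h0 hH
    have ht := t_cases H
    cases C with
    | chain n =>
      simp only [openVal, W_cons, wt, t_chain] at *
      have := le_abs_self (value H - 2); omega
    | loop n =>
      simp only [openVal, W_cons, wt, t_loop] at *
      have := le_abs_self (value H - 4); omega

lemma W_nonneg (G : Position) (hG : ∀ C ∈ G, Ok 4 C) (h6 : Component.loop 6 ∉ G) : 0 ≤ W G := by
  induction G using Multiset.induction with
  | empty => simp
  | cons C G ih =>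
    have := ih (fun C hC => hG C (by simp [hC])) (fun h => h6 (by simp [h]))
    have hC := hG C (by simp)
    cases C with
    | chain n => simp only [W_cons, wt, Ok] at *; omega
    | loop n =>
      have : n ≠ 6 := by rintro rfl; simp at h6
      simp only [W_cons, wt, Ok] at *; omega

lemma upper (G : Position) (h : G ≠ 0) (hG : ∀ C ∈ G, Ok 4 C) :
    value G ≤ max (W G + t G) 4 := by
  induction G using Multiset.strongInductionOn with
  | ih G ih =>
    by_cases h6 : Component.loop 6 ∈ G
    · obtain ⟨H, rfl⟩ := Multiset.exists_cons_of_mem h6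
      have hH : ∀ C ∈ H, Ok 4 C := fun C hC => hG C (by simp [hC])
      have hv := value_le (Component.loop 6) H
      by_cases h0 : H = 0
      · subst h0
        simp [openVal, wt, value_zero] at *; omega
      have h1 := ih H (Multiset.lt_cons_self _ _) h0 hH
      have h2 := value_two H h0 hH
      simp only [openVal, W_cons, wt, t_loop] at *
      rcases abs_cases (value H - 4) with h | h <;> omega
    by_cases hl : ∃ n, Component.loop n ∈ G
    · obtain ⟨n, hn⟩ := hl
      have hn6 : n ≠ 6 := by rintro rfl; exact h6 hn
      obtain ⟨H, rfl⟩ := Multiset.exists_cons_of_mem hn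
      have hH : ∀ C ∈ H, Ok 4 C := fun C hC => hG C (by simp [hC])
      have hC := hG _ hn
      have hv := value_le (Component.loop n) H
      by_cases h0 : H = 0
      · subst h0
        simp [openVal, wt, value_zero] at *; omega
      have h1 := ih H (Multiset.lt_cons_self _ _) h0 hH
      have h2 := lower H h0 hH
      have h3 := W_nonneg H hH (fun h => h6 (by simp [h]))
      have ht := t_cases H
      simp only [openVal, W_cons, wt, t_loop, Ok] at *
      rcases abs_cases (value H - 4) with h | h <;> omega
    · obtain ⟨C, hC⟩ := Multiset.exists_mem_of_ne_zero h
      cases C with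
      | loop n => exact absurd ⟨n, hC⟩ hl
      | chain n =>
      obtain ⟨H, rfl⟩ := Multiset.exists_cons_of_mem hC
      have hH : ∀ C ∈ H, Ok 4 C := fun C hC => hG C (by simp [hC])
      have hCo := hG _ hC
      have hv := value_le (Component.chain n) H
      by_cases h0 : H = 0
      · subst h0
        simp [openVal, wt, value_zero] at *; omega
      have h1 := ih H (Multiset.lt_cons_self _ _) h0 hH
      have h2 := lower H h0 hH
      have h3 := W_nonneg H hH (fun h => h6 (by simp [h]))
      have ht : t H = 4 := by
        obtain ⟨D, hD⟩ := Multiset.exists_mem_of_ne_zero h0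
        cases D with
        | loop m => exact absurd ⟨m, by simp [hD]⟩ hl
        | chain m =>
          obtain ⟨H', rfl⟩ := Multiset.exists_cons_of_mem hD
          simp
      simp only [openVal, W_cons, wt, t_chain, Ok] at *
      rcases abs_cases (value H - 2) with h | h <;> omega

lemma W_size (G : Position) : (W G - size G) % 4 = 0 := by
  induction G using Multiset.induction with
  | empty => simp
  | cons C G ih =>
    cases C <;> simp only [W_cons, wt, size_cons', Component.size] <;> push_cast <;> omega

lemma mod4 (G : Position) (h : G ≠ 0) (hG : ∀ C ∈ G, Ok 4 C) (he : size G % 2 = 0) :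
    (value G - size G) % 4 = 0 := by
  induction G using Multiset.strongInductionOn with
  | ih G ih =>
    have hup := upper G h hG
    have hlo := lower G h hG
    have hlo2 := value_two G h hG
    have hpar := value_parity G
    have hW := W_size G
    have ht := t_cases G
    by_cases hc : 4 ≤ W G + t G
    · omega
    have h6 : Component.loop 6 ∈ G := by
      by_contra h6
      have := W_nonneg G hG h6
      omega
    have key : size G % 4 = 2 → value G = 2 := by
      intro hs
      obtain ⟨H, rfl⟩ := Multiset.exists_cons_of_mem h6
      have hH : ∀ C ∈ H, Ok 4 C := fun C hC => hG C (by simp [hC])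
      have hv := value_le (Component.loop 6) H
      by_cases h0 : H = 0
      · subst h0
        simp [wt] at hc
      simp only [size_cons', Component.size, W_cons, t_loop, wt] at *
      have h1 := ih H (Multiset.lt_cons_self _ _) h0 hH (by omega)
      have h2 := value_two H h0 hH
      have h3 := upper H h0 hH
      simp only [openVal] at hv
      rcases abs_cases (value H - 4) with h | h <;> omega
    by_cases hs : size G % 4 = 2
    · have := key hs; omega
    have : value G ≠ 2 := by
      intro hv2
      obtain ⟨C, H, rfl, e⟩ := value_ex G h
      have hC := hG C (by simp)
      have hH : ∀ C ∈ H, Ok 4 C := fun C hC => hG C (by simp [hC])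
      rw [hv2] at e
      by_cases h0 : H = 0
      · subst h0
        cases C <;> simp [openVal, value_zero, Ok] at * <;> omega
      have h2 := value_two H h0 hH
      have ih' := ih H (Multiset.lt_cons_self _ _) h0 hH
      cases C with
      | chain n =>
        simp only [openVal, Ok, size_cons', Component.size] at *
        rcases abs_cases (value H - 2) with h | h <;>
        · obtain rfl : n = 4 := by omega
          have := ih' (by omega)
          omega
      | loop n =>
        simp only [openVal, Ok, size_cons', Component.size] at *
        rcases abs_cases (value H - 4) with h | h <;>
        · obtain rfl : n = 6 := by omega
          have := ih' (by omega)
          omega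
    omega

lemma value_three : value {Component.chain 3} = 3 := by
  obtain ⟨C, H, h, e⟩ := value_ex {Component.chain 3} (by simp)
  have := (Multiset.cons_eq_cons (a := Component.chain 3) (as := 0)).1 h
  simp at this
  obtain ⟨rfl, rfl⟩ := this
  rw [e]; simp [openVal, value_zero]

/-- loops of even length at least 6 -/
def Lp (L : Position) : Prop := ∀ C ∈ L, ∃ n, C = Component.loop n ∧ 6 ≤ n ∧ n % 2 = 0

lemma Lp.ok {L : Position} (h : Lp L) : ∀ C ∈ L, Ok 4 C := by
  intro C hC
  obtain ⟨n, rfl, h⟩ := h C hC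
  exact h

lemma Lp.t {L : Position} (h : Lp L) : t L = 8 := by
  rw [DotsAndBoxes.t, if_neg]
  rintro ⟨C, hC, h'⟩
  obtain ⟨n, rfl, _⟩ := h C hC
  simp [Component.isChain] at h'

lemma lower3 (L : Position) (h : L ≠ 0) (hL : Lp L) :
    W L + 5 ≤ value (Component.chain 3 ::ₘ L) := by
  induction L using Multiset.strongInductionOn with
  | ih L ih =>
    obtain ⟨C, H, h', e⟩ := value_ex (Component.chain 3 ::ₘ L) (by simp)
    rw [e]
    rcases Multiset.cons_eq_cons.1 h' with ⟨rfl, rfl⟩ | ⟨-, cs, rfl, rfl⟩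
    · have := lower L h hL.ok
      rw [hL.t] at this
      simp only [openVal]
      have := le_abs_self (value L - 2); omega
    · obtain ⟨n, rfl, hn⟩ := hL C (by simp)
      by_cases h0 : cs = 0
      · subst h0
        have := value_three
        simp [openVal, wt, this]; omega
      have := ih cs (Multiset.lt_cons_self _ _) h0 (fun C hC => hL C (by simp [hC]))
      simp only [openVal, W_cons, wt]
      have := le_abs_self (value (Component.chain 3 ::ₘ cs) - 4); omega

lemma Lp_par {L : Position} (hL : Lp L) : W L % 2 = 0 := by
  induction L using Multiset.induction with
  | empty => simp
  | cons C G ih =>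
    have := ih (fun C hC => hL C (by simp [hC]))
    obtain ⟨n, rfl, hn⟩ := hL C (by simp)
    simp only [W_cons, wt]; omega

lemma upper3 (L : Position) (h : L ≠ 0) (hL : Lp L) :
    value (Component.chain 3 ::ₘ L) ≤ max (W L + 5) 3 := by
  induction L using Multiset.strongInductionOn with
  | ih L ih =>
    have hp := Lp_par hL
    by_cases hc : W L + 5 ≤ 1
    · have h1 := upper L h hL.ok
      have h2 := value_two L h hL.ok
      have hv := value_le (Component.chain 3) L
      rw [hL.t] at h1
      simp only [openVal] at hv
      rcases abs_cases (value L - 2) with h | h <;> omega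
    · have : ∃ n, Component.loop n ∈ L ∧ (n = 6 ∨ Component.loop 6 ∉ L) := by
        by_cases h6 : Component.loop 6 ∈ L
        · exact ⟨6, h6, Or.inl rfl⟩
        · obtain ⟨C, hC⟩ := Multiset.exists_mem_of_ne_zero h
          obtain ⟨n, rfl, hn⟩ := hL C hC
          exact ⟨n, hC, Or.inr h6⟩
      obtain ⟨n, hn, h6⟩ := this
      obtain ⟨H, rfl⟩ := Multiset.exists_cons_of_mem hn
      have hH : Lp H := fun C hC => hL C (by simp [hC])
      have hv := value_le (Component.loop n) (Component.chain 3 ::ₘ H)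
      rw [Multiset.cons_swap] at hv
      by_cases h0 : H = 0
      · subst h0
        have := value_three
        simp [openVal, wt, this] at *; omega
      have h1 := ih H (Multiset.lt_cons_self _ _) h0 hH
      have h2 := lower3 H h0 hH
      have h3 : n = 6 ∨ 0 ≤ W H := by
        rcases h6 with h6 | h6
        · exact Or.inl h6
        · exact Or.inr (W_nonneg H hH.ok (fun h => h6 (by simp [h])))
      simp only [openVal, W_cons, wt] at *
      rcases abs_cases (value (Component.chain 3 ::ₘ H) - 4) with h | h <;> omega

lemma tb_single : tb (Component.chain 3 ::ₘ 0) = 4 := by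
  simp [tb, Component.isLoop]

lemma tb_dup (H : Position) : tb (Component.chain 3 ::ₘ Component.chain 3 ::ₘ H)
    = tb (Component.chain 3 ::ₘ H) := by
  have hm : ∀ C, C ∈ Component.chain 3 ::ₘ Component.chain 3 ::ₘ H ↔
      C ∈ Component.chain 3 ::ₘ H := by intro C; simp
  have hl : ∀ K : Position, ¬ ∀ C ∈ Component.chain 3 ::ₘ K, C.isLoop = true := by
    intro K h
    have := h (Component.chain 3) (Multiset.mem_cons_self _ _)
    simp [Component.isLoop] at this
  rw [tb, tb, if_neg (Multiset.cons_ne_zero), if_neg (Multiset.cons_ne_zero),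
    if_neg (hl _), if_neg (hl _)]
  classical
  apply if_congr _ rfl rfl
  simp only [hm]

lemma tb_chain {H : Position} (h : HC H) (h3 : Component.chain 3 ∉ H) :
    tb (Component.chain 3 ::ₘ H) = 4 := by
  obtain ⟨C, hC, h⟩ := h
  rw [tb, if_neg (by simp), if_neg (by simp [Component.isLoop]), if_neg]
  rintro ⟨-, -, h'⟩
  have := h' C (by simp [hC]) h
  exact h3 (this ▸ hC)

lemma tb_loops {H : Position} (h0 : H ≠ 0) (h : Lp H) :
    tb (Component.chain 3 ::ₘ H) = 6 := by
  rw [tb, if_neg (by simp), if_neg (by simp [Component.isLoop]), if_pos]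
  refine ⟨?_, by simp, ?_⟩
  · obtain ⟨C, hC⟩ := Multiset.exists_mem_of_ne_zero h0
    obtain ⟨n, rfl, hn⟩ := h C hC
    exact ⟨_, Multiset.mem_cons_of_mem hC, rfl⟩
  · intro C hC hc
    rcases Multiset.mem_cons.1 hC with rfl | hC
    · rfl
    · obtain ⟨n, rfl, hn⟩ := h C hC
      simp [Component.isChain] at hc

lemma lp_of_not_HC {H : Position} (h : ¬ HC H) (hH : ∀ C ∈ H, Ok 3 C) : Lp H := by
  intro C hC
  have := hH C hC
  cases C with
  | chain n => exact absurd ⟨_, hC, rfl⟩ h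
  | loop n => exact ⟨n, rfl, this⟩

lemma ok4 {H : Position} (h : Component.chain 3 ∉ H) (hH : ∀ C ∈ H, Ok 3 C) :
    ∀ C ∈ H, Ok 4 C := by
  intro C hC
  have := hH C hC
  cases C with
  | chain n =>
    have : n ≠ 3 := by rintro rfl; exact h hC
    simp only [Ok] at *; omega
  | loop n => exact this

lemma upperU (H : Position) (hH : ∀ C ∈ H, Ok 3 C) :
    value (Component.chain 3 ::ₘ H) ≤ max (cval (Component.chain 3 ::ₘ H)) 3 := by
  induction H using Multiset.strongInductionOn with
  | ih H ih =>
    have hv := value_le (Component.chain 3) H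
    by_cases h3 : Component.chain 3 ∈ H
    · obtain ⟨K, rfl⟩ := Multiset.exists_cons_of_mem h3
      have h1 := ih K (Multiset.lt_cons_self _ _) (fun C hC => hH C (by simp [hC]))
      have h2 := value_pos _ (by simp) hH
      have h4 := tb_dup K
      simp only [cval_eq, W_cons, wt, openVal] at *
      rcases abs_cases (value (Component.chain 3 ::ₘ K) - 2) with h | h <;> omega
    by_cases h0 : H = 0
    · subst h0
      have := value_three
      have h' : value (Component.chain 3 ::ₘ 0) = 3 := this
      omega
    have ho := ok4 h3 hH
    by_cases hc : HC H
    · have h1 := upper H h0 ho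
      have h2 := value_two H h0 ho
      have h4 := tb_chain hc h3
      have h5 : t H = 4 := by rw [t, if_pos hc]
      simp only [cval_eq, W_cons, wt, openVal] at *
      rcases abs_cases (value H - 2) with h | h <;> omega
    · have hl := lp_of_not_HC hc hH
      have h1 := upper3 H h0 hl
      have h4 := tb_loops h0 hl
      simp only [cval_eq, W_cons, wt] at *
      omega

lemma main_odd (H : Position) (hH : ∀ C ∈ H, Ok 3 C) (he : size H % 2 = 0) :
    min 3 (openVal (Component.chain 3) (value H)) ≤ value (Component.chain 3 ::ₘ H) := by
  obtain ⟨C, K, h, e⟩ := value_ex (Component.chain 3 ::ₘ H) (by simp)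
  have hp := value_parity (Component.chain 3 ::ₘ H)
  rw [size_cons'] at hp
  simp only [Component.size] at hp
  rcases Multiset.cons_eq_cons.1 h with ⟨rfl, rfl⟩ | ⟨hne, cs, rfl, rfl⟩
  · rw [e]; exact min_le_right _ _
  · have hC := hH C (by simp)
    refine (min_le_left _ _).trans ?_
    cases C with
    | chain n =>
      have : n ≠ 3 := by rintro rfl; exact hne rfl
      simp only [openVal, Ok] at *
      have := abs_nonneg (value (Component.chain 3 ::ₘ cs) - 2)
      omega
    | loop n =>
      simp only [openVal, Ok] at *
      have := abs_nonneg (value (Component.chain 3 ::ₘ cs) - 4)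
      omega

theorem three_optimality_one (G : Position) (hG : G.Valid)
    (hc : cval G < 2) (hf : numF G = 0) (hth : 1 ≤ theta G) :
    Optimal G (Component.chain 3) ∧
    (Even (size G) → value G = 2) ∧
    ((theta G = 1 ∧ size G % 4 = 3) → value G = 3) ∧
    ((Odd (size G) ∧ ¬ (theta G = 1 ∧ size G % 4 = 3)) → value G = 1) := by
  have h4 : Component.loop 4 ∉ G := Multiset.count_eq_zero.1 hf
  have h3 : Component.chain 3 ∈ G := Multiset.one_le_count_iff_mem.1 hth
  have hok : ∀ C ∈ G, Ok 3 C := by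
    intro C hC
    have := hG C hC
    cases C with
    | chain n => exact this
    | loop n =>
      have hn : n ≠ 4 := by rintro rfl; exact h4 hC
      simp only [Component.Valid, Ok, Nat.even_iff] at *; omega
  obtain ⟨H, rfl⟩ := Multiset.exists_cons_of_mem h3
  have hH : ∀ C ∈ H, Ok 3 C := fun C hC => hok C (by simp [hC])
  have hv := value_le (Component.chain 3) H
  have hpos := value_pos _ (by simp) hok
  have hpG := value_parity (Component.chain 3 ::ₘ H)
  have hpH := value_parity H
  have hmo := main_odd H hH
  have hth' : theta (Component.chain 3 ::ₘ H) = theta H + 1 := by simp [theta]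
  have e : valueOpen (Component.chain 3 ::ₘ H) (Component.chain 3)
      = openVal (Component.chain 3) (value H) := by simp [valueOpen]
  rw [Optimal, e, hth', Nat.even_iff, Nat.odd_iff]
  rw [and_assoc]
  refine ⟨h3, ?_⟩
  rw [size_cons'] at *
  simp only [Component.size, openVal] at *
  by_cases hd : Component.chain 3 ∈ H
  · have hth2 : 1 ≤ theta H := Multiset.one_le_count_iff_mem.2 hd
    obtain ⟨K, rfl⟩ := Multiset.exists_cons_of_mem hd
    have hU := upperU K (fun C hC => hH C (by simp [hC]))
    have h1 := value_pos _ (by simp) hH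
    have h5 := tb_dup K
    rw [cval_eq] at *
    rw [W_cons, h5] at hc
    simp only [wt] at hc
    rcases abs_cases (value (Component.chain 3 ::ₘ K) - 2) with h | h <;> omega
  · have hth2 : theta H = 0 := Multiset.count_eq_zero.2 hd
    have ho := ok4 hd hH
    by_cases h0 : H = 0
    · subst h0
      rw [cval_eq, tb_single] at hc
      simp [wt] at hc
    have hup := upper H h0 ho
    have hlo := value_two H h0 ho
    have hm := mod4 H h0 ho
    have : value H ≤ 4 := by
      rw [cval_eq, W_cons] at hc
      simp only [wt] at hc
      by_cases hch : HC H
      · rw [tb_chain hch hd] at hc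
        have h5 : t H = 4 := by rw [t, if_pos hch]
        omega
      · have hl := lp_of_not_HC hch hH
        rw [tb_loops h0 hl] at hc
        have h5 := hl.t
        omega
    rcases abs_cases (value H - 2) with h | h <;> omega

end DotsAndBoxes
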